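/- Let k be an algebraically closed field of characteristic 0, R = k[X,Y], m = (X,Y), and let I be a proper ideal with m^r ⊆ I ⊆ m for some r ≥ 1. Let e = dim_k (I/mI) be the minimal number of generators of I and n = dim_k (R/I). Then e(e−1)/2 ≤ n, i.e. the binomial coefficient C(e, 2) is at most n. -/

import Mathlib

open MvPolynomial

/-- `dim_k (I / mI)` where `m = (X, Y)`: the minimal number of generators of `I`. -/
noncomputable def gensDim {k : Type*} [Field k] (I : Ideal (MvPolynomial (Fin 2) k)) : ℕ :=
  Module.finrank k
    (↥(I.restrictScalars k) ⧸
      (Submodule.comap (I.restrictScalars k).subtype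
        ((Ideal.span {X 0, X 1} * I).restrictScalars k)))

namespace MvPolynomial

section Field

variable {k : Type*} [Field k]

/-- Restriction of a bivariate polynomial to the line `X 0 = c * X 1`. -/
noncomputable def restrictLine (c : k) : MvPolynomial (Fin 2) k →ₐ[k] Polynomial k :=
  aeval ![Polynomial.C c * Polynomial.X, Polynomial.X]

lemma restrictLine_surjective (c : k) : Function.Surjective (restrictLine c) := by
  intro p
  refine ⟨Polynomial.aeval (X 1) p, ?_⟩
  have : (restrictLine c).comp (Polynomial.aeval (X 1 : MvPolynomial (Fin 2) k)) = AlgHom.id k (Polynomial k) := by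
    ext
    simp [restrictLine]
  exact DFunLike.congr_fun this p

lemma sub_aeval_restrictLine_mem (c : k) (f : MvPolynomial (Fin 2) k) :
    f - Polynomial.aeval (X 1) (restrictLine c f) ∈
      (Ideal.span {X 0 - C c * X 1} : Ideal (MvPolynomial (Fin 2) k)) := by
  set J : Ideal (MvPolynomial (Fin 2) k) := Ideal.span {X 0 - C c * X 1}
  have h : Ideal.Quotient.mkₐ k J =
      (Ideal.Quotient.mkₐ k J).comp ((Polynomial.aeval (X 1)).comp (restrictLine c)) := by
    refine algHom_ext fun i => ?_
    fin_cases i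
    · simp only [restrictLine, Ideal.Quotient.mkₐ_eq_mk, AlgHom.comp_apply]
      refine Ideal.Quotient.eq.mpr ?_
      simp [J]
    · simp [restrictLine]
  exact Ideal.Quotient.eq.mp (DFunLike.congr_fun h f)

lemma exists_eq_mul_of_restrictLine_eq_zero {c : k} {f : MvPolynomial (Fin 2) k}
    (hf : restrictLine c f = 0) : ∃ g, f = (X 0 - C c * X 1) * g := by
  have h := sub_aeval_restrictLine_mem c f
  rw [hf, map_zero, sub_zero] at h
  exact Ideal.mem_span_singleton.mp h

lemma sub_C_constantCoeff_mem_span (f : MvPolynomial (Fin 2) k) :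
    f - C (constantCoeff f) ∈ (Ideal.span {X 0, X 1} : Ideal (MvPolynomial (Fin 2) k)) := by
  set J : Ideal (MvPolynomial (Fin 2) k) := Ideal.span {X 0, X 1}
  have h : Ideal.Quotient.mkₐ k J =
      (Ideal.Quotient.mkₐ k J).comp ((Algebra.ofId k _).comp (aeval (fun _ => (0 : k)))) := by
    refine algHom_ext fun i => ?_
    simp only [Ideal.Quotient.mkₐ_eq_mk, AlgHom.comp_apply]
    refine Ideal.Quotient.eq.mpr ?_
    fin_cases i
    · simpa using Ideal.subset_span (by simp)
    · simpa using Ideal.subset_span (by simp)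
  have h2 := Ideal.Quotient.eq.mp (DFunLike.congr_fun h f)
  simpa [Algebra.ofId_apply, aeval_zero'] using h2

lemma coeff_coeff_aeval_monomial (s : Fin 2 →₀ ℕ) (a : k) (i j : ℕ) :
    ((aeval ![Polynomial.C Polynomial.X * Polynomial.X, Polynomial.X]
      (monomial s a) : Polynomial (Polynomial k)).coeff (i + j)).coeff i =
      if s 0 = i ∧ s 1 = j then a else 0 := by
  rw [aeval_monomial]
  simp only [Finsupp.prod_fintype, Fin.prod_univ_two, Matrix.cons_val_zero, Matrix.cons_val_one,
    pow_zero, implies_true]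
  have : (algebraMap k (Polynomial (Polynomial k)) a) *
      ((Polynomial.C Polynomial.X * Polynomial.X) ^ s 0 * Polynomial.X ^ s 1) =
      Polynomial.C (Polynomial.C a * Polynomial.X ^ s 0) * Polynomial.X ^ (s 0 + s 1) := by
    rw [mul_pow, pow_add, map_mul, map_pow]
    simp only [Polynomial.algebraMap_apply, Algebra.algebraMap_self, RingHom.id_apply]
    ring
  rw [this, Polynomial.coeff_C_mul_X_pow]
  split_ifs with h1 h2 h2
  · rw [Polynomial.coeff_C_mul_X_pow, if_pos h2.1.symm]
  · rw [Polynomial.coeff_C_mul_X_pow, if_neg (by omega)]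
  · omega
  · simp

lemma coeff_coeff_aeval (f : MvPolynomial (Fin 2) k) (s : Fin 2 →₀ ℕ) :
    ((aeval ![Polynomial.C Polynomial.X * Polynomial.X, Polynomial.X] f :
      Polynomial (Polynomial k)).coeff (s 0 + s 1)).coeff (s 0) = coeff s f := by
  induction f using MvPolynomial.induction_on' with
  | monomial u a =>
    rw [coeff_coeff_aeval_monomial, coeff_monomial]
    congr 1
    simp [Finsupp.ext_iff, Fin.forall_fin_two]
  | add p q hp hq => simp [hp, hq]

lemma coeff_eq_zero_of_pow_dvd_restrictLine [Infinite k] {f : MvPolynomial (Fin 2) k} {d : ℕ}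
    (h : ∀ c, Polynomial.X ^ d ∣ restrictLine c f) {s : Fin 2 →₀ ℕ} (hs : s 0 + s 1 < d) :
    coeff s f = 0 := by
  rw [← coeff_coeff_aeval]
  set F : Polynomial (Polynomial k) :=
    aeval ![Polynomial.C Polynomial.X * Polynomial.X, Polynomial.X] f
  suffices F.coeff (s 0 + s 1) = 0 by simp [this]
  refine Polynomial.funext fun c => ?_
  have hc : (Polynomial.mapAlgHom (Polynomial.aeval c)).comp
      (aeval ![Polynomial.C Polynomial.X * Polynomial.X, Polynomial.X]) = restrictLine c := by
    refine algHom_ext fun i => ?_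
    fin_cases i <;> simp [restrictLine]
  have h0 := Polynomial.X_pow_dvd_iff.mp (h c) _ hs
  rw [← hc] at h0
  simpa [F, Polynomial.coe_aeval_eq_eval] using h0

lemma finite_quotient_of_span_pow_le {I : Ideal (MvPolynomial (Fin 2) k)} {r : ℕ}
    (h : (Ideal.span {X 0, X 1} : Ideal (MvPolynomial (Fin 2) k)) ^ r ≤ I) :
    Module.Finite k (MvPolynomial (Fin 2) k ⧸ I) := by
  let π := (Ideal.Quotient.mkₐ k I).toLinearMap
  have hX (i : Fin 2) : (X i : MvPolynomial (Fin 2) k) ^ r ∈ I :=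
    h (Ideal.pow_mem_pow (Ideal.subset_span (by fin_cases i <;> simp)) r)
  let S : Set (Fin 2 →₀ ℕ) := Set.Iic (Finsupp.equivFunOnFinite.symm fun _ => r)
  have hS : S.Finite := Set.finite_Iic _
  refine ⟨Submodule.fg_def.mpr ⟨_, hS.image fun s => π (monomial s 1), top_unique ?_⟩⟩
  have htop : Submodule.span k (Set.range fun s => π (monomial s 1)) = ⊤ := by
    have := congrArg (Submodule.map π) (basisMonomials (Fin 2) k).span_eq
    rwa [Submodule.map_span, ← Set.range_comp, Submodule.map_top,
      LinearMap.range_eq_top.mpr (Ideal.Quotient.mkₐ_surjective k I)] at this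
  rw [← htop, Submodule.span_le]
  rintro _ ⟨s, rfl⟩
  by_cases hs : s ∈ S
  · exact Submodule.subset_span ⟨s, hs, rfl⟩
  · obtain ⟨i, hi⟩ : ∃ i, r < s i := by
      simp only [S, Set.mem_Iic, Finsupp.le_def, not_forall, not_le] at hs
      exact hs
    have : monomial s (1 : k) ∈ I := by
      rw [monomial_eq, Finsupp.prod_fintype _ _ (fun _ => pow_zero _)]
      refine I.mul_mem_left _ (I.mem_of_dvd (Finset.dvd_prod_of_mem _ (Finset.mem_univ i)) ?_)
      exact I.pow_mem_of_pow_mem (hX i) hi.le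
    have h0 : π (monomial s 1) = 0 := Ideal.Quotient.eq_zero_iff_mem.mpr this
    simp [h0]

lemma choose_two_le_finrank_quotient {I : Ideal (MvPolynomial (Fin 2) k)}
    [Module.Finite k (MvPolynomial (Fin 2) k ⧸ I)] {d : ℕ}
    (h : ∀ f ∈ I, ∀ s : Fin 2 →₀ ℕ, s 0 + s 1 < d → coeff s f = 0) :
    (d + 1).choose 2 ≤ Module.finrank k (MvPolynomial (Fin 2) k ⧸ I) := by
  let e (x : Σ n : Fin d, Fin (n + 1)) : Fin 2 →₀ ℕ :=
    Finsupp.equivFunOnFinite.symm ![x.2, x.1 - x.2]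
  have he : Function.Injective e := by
    rintro ⟨n, i⟩ ⟨m, j⟩ hij
    have h0 : (i : ℕ) = j := DFunLike.congr_fun hij 0
    have h1 : (n : ℕ) - i = m - j := DFunLike.congr_fun hij 1
    obtain rfl : n = m := Fin.ext (by omega)
    obtain rfl : i = j := Fin.ext h0
    rfl
  have hcard : (d + 1).choose 2 = Fintype.card (Σ n : Fin d, Fin (n + 1)) := by
    simp only [Fintype.card_sigma, Fintype.card_fin]
    rw [Fin.sum_univ_eq_sum_range (fun n => n + 1), Nat.choose_two_right, ← Finset.sum_range_id,
      Finset.sum_range_succ', add_zero]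
  rw [hcard]
  refine LinearIndependent.fintype_card_le_finrank
    (b := fun x => Ideal.Quotient.mkₐ k I (monomial (e x) 1)) ?_
  rw [Fintype.linearIndependent_iff]
  intro g hg x
  have hmem : ∑ x, monomial (e x) (g x) ∈ I := by
    rw [← Ideal.Quotient.eq_zero_iff_mem, ← hg, map_sum]
    refine Finset.sum_congr rfl fun x _ => ?_
    rw [← map_smul, smul_monomial, smul_eq_mul, mul_one]
    rfl
  have := h _ hmem (e x) (by
    have := x.1.isLt
    have := x.2.isLt
    simp only [e, Finsupp.equivFunOnFinite_symm_apply_apply, Matrix.cons_val_zero,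
      Matrix.cons_val_one]
    omega)
  simpa [coeff_sum, coeff_monomial, he.eq_iff] using this

lemma gensDim_le_finrank_quotient_map_restrictLine (I : Ideal (MvPolynomial (Fin 2) k))
    [Module.Finite k (MvPolynomial (Fin 2) k ⧸ I)] (c : k) :
    gensDim I ≤ Module.finrank k (Polynomial k ⧸ I.map (restrictLine c)) + 1 := by
  unfold gensDim
  set l : MvPolynomial (Fin 2) k := X 0 - C c * X 1
  let A := MvPolynomial (Fin 2) k ⧸ I
  let π : MvPolynomial (Fin 2) k →ₗ[k] A := (Ideal.Quotient.mkₐ k I).toLinearMap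
  have hπ : Function.Surjective π := Ideal.Quotient.mkₐ_surjective k I
  have hπ0 {x} : π x = 0 ↔ x ∈ I := Ideal.Quotient.eq_zero_iff_mem
  let L : A →ₗ[k] A := LinearMap.mulLeft k (Ideal.Quotient.mk I l)
  have hL (x) : L (π x) = π (l * x) := (map_mul (Ideal.Quotient.mk I) l x).symm
  have hφ := restrictLine_surjective c
  have hker : Module.finrank k (LinearMap.ker L) ≤
      Module.finrank k (Polynomial k ⧸ I.map (restrictLine c)) := by
    let q : A →ₐ[k] Polynomial k ⧸ I.map (restrictLine c) :=
      Ideal.quotientMapₐ _ (restrictLine c) Ideal.le_comap_map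
    have hq : Function.Surjective q :=
      Ideal.quotientMap_surjective (H := Ideal.le_comap_map) hφ
    have hle : LinearMap.ker q.toLinearMap ≤ LinearMap.range L := by
      intro x hx
      obtain ⟨x, rfl⟩ := hπ x
      have hx : restrictLine c x ∈ I.map (restrictLine c) := Ideal.Quotient.eq_zero_iff_mem.mp hx
      obtain ⟨y, hy, hxy⟩ := (Ideal.mem_map_iff_of_surjective _ hφ).mp hx
      obtain ⟨g, hg⟩ := exists_eq_mul_of_restrictLine_eq_zero (c := c) (f := x - y)
        (by rw [map_sub, hxy, sub_self])
      refine ⟨π g, ?_⟩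
      rw [hL, ← hg, map_sub, hπ0.mpr hy, sub_zero]
    have h1 := LinearMap.finrank_range_add_finrank_ker L
    have h2 := LinearMap.finrank_range_add_finrank_ker q.toLinearMap
    rw [LinearMap.range_eq_top.mpr hq, finrank_top] at h2
    have h3 := Submodule.finrank_mono hle
    omega
  obtain ⟨f, hfI, hf⟩ := (Ideal.mem_map_iff_of_surjective _ hφ).mp
    (Submodule.IsPrincipal.generator_mem (I.map (restrictLine c)))
  obtain ⟨σ, hσ⟩ := π.exists_rightInverse_of_surjective (LinearMap.range_eq_top.mpr hπ)
  replace hσ (x) : π (σ x) = x := DFunLike.congr_fun hσ x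
  set M := (Ideal.span {X 0, X 1} * I : Ideal (MvPolynomial (Fin 2) k))
  let ρ := (Submodule.comap (I.restrictScalars k).subtype (M.restrictScalars k)).mkQ
  let ψ : LinearMap.ker L →ₗ[k] I.restrictScalars k :=
    ((LinearMap.mulLeft k l).comp (σ.comp (LinearMap.ker L).subtype)).codRestrict _ fun x => by
      refine hπ0.mp ?_
      exact (hL _).symm.trans ((congrArg L (hσ x)).trans x.2)
  let Ψ : LinearMap.ker L × k →ₗ[k] I.restrictScalars k :=
    ψ.coprod (LinearMap.toSpanSingleton k _ ⟨f, hfI⟩)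
  have hl : l ∈ (Ideal.span {X 0, X 1} : Ideal (MvPolynomial (Fin 2) k)) :=
    Ideal.sub_mem _ (Ideal.subset_span (by simp))
      (Ideal.mul_mem_left _ _ (Ideal.subset_span (by simp)))
  have hΨ : Function.Surjective (ρ.comp Ψ) := by
    intro g
    obtain ⟨⟨g, hg⟩, rfl⟩ := Submodule.mkQ_surjective _ g
    obtain ⟨p, hp⟩ := (Submodule.IsPrincipal.mem_iff_generator_dvd _).mp
      (Ideal.mem_map_of_mem (restrictLine c) hg)
    obtain ⟨h, rfl⟩ := hφ p
    obtain ⟨n, hn⟩ := exists_eq_mul_of_restrictLine_eq_zero (c := c) (f := g - f * h)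
      (by rw [map_sub, map_mul, hf, hp, sub_self])
    have hln : l * n ∈ I := hn ▸ I.sub_mem hg (I.mul_mem_right _ hfI)
    refine ⟨(⟨π n, ?_⟩, constantCoeff h), ?_⟩
    · rw [LinearMap.mem_ker, hL, hπ0]
      exact hln
    · refine (Submodule.Quotient.eq _).mpr ?_
      change l * σ (π n) + constantCoeff h • f - g ∈ M
      have h1 : l * (σ (π n) - n) ∈ M :=
        Ideal.mul_mem_mul hl (hπ0.mp (by rw [map_sub, hσ, sub_self]))
      have h2 : (h - C (constantCoeff h)) * f ∈ M :=
        Ideal.mul_mem_mul (sub_C_constantCoeff_mem_span h) hfI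
      convert M.sub_mem h1 h2 using 1
      rw [smul_eq_C_mul]
      linear_combination -hn
  have h4 := LinearMap.finrank_range_add_finrank_ker (ρ.comp Ψ)
  rw [LinearMap.range_eq_top.mpr hΨ, finrank_top, Module.finrank_prod, Module.finrank_self] at h4
  omega

end Field

end MvPolynomial

/-- For an `m`-primary ideal `I ⊆ k[X,Y]` with minimal number of generators
`e = dim_k(I/mI)` and colength `n = dim_k(R/I)`, one has `C(e, 2) = e(e−1)/2 ≤ n`. -/
theorem choose_gens_two_le {k : Type*} [Field k] [IsAlgClosed k] [CharZero k]
    (I : Ideal (MvPolynomial (Fin 2) k)) (r : ℕ) (hr : 1 ≤ r)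
    (hmI : (Ideal.span {X 0, X 1} : Ideal (MvPolynomial (Fin 2) k)) ^ r ≤ I)
    (hIm : I ≤ Ideal.span {X 0, X 1}) :
    Nat.choose (gensDim I) 2 ≤ Module.finrank k (MvPolynomial (Fin 2) k ⧸ I) := by
  have := finite_quotient_of_span_pow_le hmI
  have hmap (c : k) : ∃ n, I.map (restrictLine c) = Ideal.span {Polynomial.X ^ n} := by
    have hX : (Polynomial.X : Polynomial k) ^ r ∈ I.map (restrictLine c) := by
      have h1 : (X 1 : MvPolynomial (Fin 2) k) ^ r ∈ I :=
        hmI (Ideal.pow_mem_pow (Ideal.subset_span (by simp)) r)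
      simpa [restrictLine] using Ideal.mem_map_of_mem (restrictLine c) h1
    rw [Submodule.IsPrincipal.mem_iff_generator_dvd, dvd_prime_pow Polynomial.prime_X] at hX
    obtain ⟨n, -, hn⟩ := hX
    exact ⟨n, by rw [← Ideal.span_singleton_eq_span_singleton.mpr hn,
      Ideal.span_singleton_generator]⟩
  choose n hn using hmap
  obtain ⟨c, hc⟩ : ∃ c, ∀ c', n c ≤ n c' :=
    ⟨Function.argmin n, fun c' => Function.argmin_le n c'⟩
  have hcoeff : ∀ f ∈ I, ∀ s : Fin 2 →₀ ℕ, s 0 + s 1 < n c → coeff s f = 0 := fun f hf s hs =>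
    coeff_eq_zero_of_pow_dvd_restrictLine (fun c' => (pow_dvd_pow _ (hc c')).trans
      (Ideal.mem_span_singleton.mp (hn c' ▸ Ideal.mem_map_of_mem _ hf))) hs
  have hgens := gensDim_le_finrank_quotient_map_restrictLine I c
  rw [hn, finrank_quotient_span_eq_natDegree, Polynomial.natDegree_X_pow] at hgens
  exact (Nat.choose_le_choose 2 hgens).trans (choose_two_le_finrank_quotient hcoeff)
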